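/- Finite degree is preserved by action modalities: let A = (Σ, E, PRE) be an event model with events α_0, …, α_{n−1}. If a formula φ has finite degree and each precondition Pre_{α_0}, …, Pre_{α_{n−1}} has finite degree, then for every event α ∈ Σ the formula ⟨α⟩φ has finite degree; indeed its degree is at most k* = max{deg(Pre_{α_0}), …, deg(Pre_{α_{n−1}})} + deg(φ). -/

import Mathlib

/-- A relational model over a set of worlds `W`. -/
structure Model (W : Type) where
  rel : W → W → Prop
  val : ℕ → Set W

/-- Change the valuation of the proposition letter `p` to `X`. -/
def Model.update {W : Type} (M : Model W) (p : ℕ) (X : Set W) : Model W :=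
  ⟨M.rel, fun q => if q = p then X else M.val q⟩

/-- Restriction (relativisation) of a model to a subset of its domain. -/
def Model.restrict {W : Type} (M : Model W) (A : Set W) : Model A :=
  ⟨fun a b => M.rel a.1 b.1, fun p => {a | a.1 ∈ M.val p}⟩

/-- The language `L∃U`: propositionally quantified modal logic with the global modality. -/
inductive Form : Type where
  | atom : ℕ → Form
  | neg : Form → Form
  | and : Form → Form → Form
  | box : Form → Form
  | ex : ℕ → Form → Form
  | uni : Form → Form

/-- Satisfaction for `L∃U`. -/
def Sat {W : Type} : Model W → W → Form → Prop
  | M, w, .atom p => w ∈ M.val p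
  | M, w, .neg φ => ¬ Sat M w φ
  | M, w, .and φ ψ => Sat M w φ ∧ Sat M w ψ
  | M, w, .box φ => ∀ v, M.rel w v → Sat M v φ
  | M, w, .ex p φ => ∃ X : Set W, Sat (M.update p X) w φ
  | M, w, .uni φ => ∀ v, Sat M v φ

/-- Material implication, `φ ⊃ ψ`. -/
def Form.imp (φ ψ : Form) : Form := .neg (.and φ (.neg ψ))

/-- The proposition letter `p` occurs in a formula. -/
def Form.Occurs (p : ℕ) : Form → Prop
  | .atom q => q = p
  | .neg φ => φ.Occurs p
  | .and φ ψ => φ.Occurs p ∨ ψ.Occurs p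
  | .box φ => φ.Occurs p
  | .ex q φ => q = p ∨ φ.Occurs p
  | .uni φ => φ.Occurs p

/-- The formula contains no global modality `U` (i.e. is in `L∃`). -/
def Form.UFree : Form → Prop
  | .atom _ => True
  | .neg φ => φ.UFree
  | .and φ ψ => φ.UFree ∧ ψ.UFree
  | .box φ => φ.UFree
  | .ex _ φ => φ.UFree
  | .uni _ => False

/-- Semantics of the dynamic relativisation (public announcement) modality `⟨!A⟩φ`. -/
def SatRel {W : Type} (M : Model W) (w : W) (A φ : Form) : Prop :=
  ∃ h : w ∈ {v | Sat M v A}, Sat (M.restrict {v | Sat M v A}) ⟨w, h⟩ φ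

/-- An event model with `n` events `α_0, …, α_{n-1}`, preconditions in `L∃U`. -/
structure EventModel (n : ℕ) where
  E : Fin n → Fin n → Prop
  pre : Fin n → Form

/-- The domain of the product update `M ⊗ A`. -/
def prodDomain {W : Type} (M : Model W) {n : ℕ} (A : EventModel n) : Set (W × Fin n) :=
  {x | Sat M x.1 (A.pre x.2)}

/-- The product update `M ⊗ A`. -/
def prodModel {W : Type} (M : Model W) {n : ℕ} (A : EventModel n) :
    Model (prodDomain M A) :=
  ⟨fun x y => M.rel x.1.1 y.1.1 ∧ A.E x.1.2 y.1.2, fun p => {x | x.1.1 ∈ M.val p}⟩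

/-- Semantics of the action modality `⟨α⟩φ` for `φ ∈ L∃U`. -/
def SatAct {W : Type} {n : ℕ} (M : Model W) (A : EventModel n) (α : Fin n) (w : W)
    (φ : Form) : Prop :=
  ∃ h : (w, α) ∈ prodDomain M A, Sat (prodModel M A) ⟨(w, α), h⟩ φ

/-- The set of sentences `S∃Uj`: `L∃U` plus action nominals `j_i`. -/
inductive FormJ (n : ℕ) : Type where
  | atom : ℕ → FormJ n
  | nom : Fin n → FormJ n
  | neg : FormJ n → FormJ n
  | and : FormJ n → FormJ n → FormJ n
  | box : FormJ n → FormJ n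
  | ex : ℕ → FormJ n → FormJ n
  | uni : FormJ n → FormJ n

/-- Satisfaction for `S∃Uj`, relative to a labelling of worlds by events
(in a product model `M ⊗ A` the label of `(ω, α)` is `α`). -/
def SatJ {n : ℕ} {V : Type} (lab : V → Fin n) : Model V → V → FormJ n → Prop
  | M, w, .atom p => w ∈ M.val p
  | _, w, .nom i => lab w = i
  | M, w, .neg φ => ¬ SatJ lab M w φ
  | M, w, .and φ ψ => SatJ lab M w φ ∧ SatJ lab M w ψ
  | M, w, .box φ => ∀ v, M.rel w v → SatJ lab M v φ
  | M, w, .ex p φ => ∃ X : Set V, SatJ lab (M.update p X) w φ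
  | M, w, .uni φ => ∀ v, SatJ lab M v φ

/-- Semantics of the action modality `⟨α⟩ψ` applied to a sentence `ψ ∈ S∃Uj`:
`M, w ⊨ ⟨α⟩ψ` iff `M, w ⊨ Pre_α` and `M ⊗ A, (w, α) ⊨ ψ`. -/
def SatActJ {W : Type} {n : ℕ} (M : Model W) (A : EventModel n) (α : Fin n) (w : W)
    (ψ : FormJ n) : Prop :=
  ∃ h : (w, α) ∈ prodDomain M A,
    SatJ (fun x : prodDomain M A => x.1.2) (prodModel M A) ⟨(w, α), h⟩ ψ

/-- The proposition letter `p` occurs in a sentence of `S∃Uj`. -/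
def FormJ.Occurs {n : ℕ} (p : ℕ) : FormJ n → Prop
  | .atom q => q = p
  | .nom _ => False
  | .neg φ => φ.Occurs p
  | .and φ ψ => φ.Occurs p ∨ ψ.Occurs p
  | .box φ => φ.Occurs p
  | .ex q φ => q = p ∨ φ.Occurs p
  | .uni φ => φ.Occurs p

/-- Substitution `φ(σ)` of the sentence `σ` for the proposition letter `p` in `φ`. -/
def FormJ.subst {n : ℕ} (p : ℕ) (σ : FormJ n) : FormJ n → FormJ n
  | .atom q => if q = p then σ else .atom q
  | .nom i => .nom i
  | .neg φ => .neg (FormJ.subst p σ φ)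
  | .and φ ψ => .and (FormJ.subst p σ φ) (FormJ.subst p σ ψ)
  | .box φ => .box (FormJ.subst p σ φ)
  | .ex q φ => if q = p then .ex q φ else .ex q (FormJ.subst p σ φ)
  | .uni φ => .uni (FormJ.subst p σ φ)

/-- Disjunction, defined from `¬` and `∧`. -/
def FormJ.or {n : ℕ} (φ ψ : FormJ n) : FormJ n := .neg (.and (.neg φ) (.neg ψ))

/-- Finite disjunction `⋁`. -/
def FormJ.bigOr {n : ℕ} : List (FormJ n) → FormJ n
  | [] => .and (.atom 0) (.neg (.atom 0))
  | [φ] => φ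
  | φ :: ψ :: rest => φ.or (FormJ.bigOr (ψ :: rest))

/-- Simultaneous update of the valuation of the (distinct) letters `ps i` to `X i`. -/
def Model.updateMany {W : Type} (M : Model W) {n : ℕ} (ps : Fin n → ℕ)
    (X : Fin n → Set W) : Model W :=
  ⟨M.rel, fun q => {w | (∃ i, ps i = q ∧ w ∈ X i) ∨ ((∀ i, ps i ≠ q) ∧ w ∈ M.val q)}⟩

/-- A concrete numerical encoding of `L∃U` formulas. -/
def Form.toNat : Form → ℕ
  | .atom p => Nat.pair 0 p
  | .neg φ => Nat.pair 1 φ.toNat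
  | .and φ ψ => Nat.pair 2 (Nat.pair φ.toNat ψ.toNat)
  | .box φ => Nat.pair 3 φ.toNat
  | .ex p φ => Nat.pair 4 (Nat.pair p φ.toNat)
  | .uni φ => Nat.pair 5 φ.toNat

/-- The language `L∃Uα`: `L∃U` with action modalities `⟨α⟩` for events `α` of an event model. -/
inductive FormA (n : ℕ) : Type where
  | atom : ℕ → FormA n
  | neg : FormA n → FormA n
  | and : FormA n → FormA n → FormA n
  | box : FormA n → FormA n
  | ex : ℕ → FormA n → FormA n
  | uni : FormA n → FormA n
  | act : Fin n → FormA n → FormA n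

/-- Satisfaction for `L∃Uα`, relative to a fixed event model `A`. -/
def SatA {n : ℕ} (A : EventModel n) : (W : Type) → Model W → W → FormA n → Prop
  | _, M, w, .atom p => w ∈ M.val p
  | W, M, w, .neg φ => ¬ SatA A W M w φ
  | W, M, w, .and φ ψ => SatA A W M w φ ∧ SatA A W M w ψ
  | W, M, w, .box φ => ∀ v, M.rel w v → SatA A W M v φ
  | W, M, w, .ex p φ => ∃ X : Set W, SatA A W (M.update p X) w φ
  | W, M, w, .uni φ => ∀ v, SatA A W M v φ
  | _, M, w, .act β φ => ∃ h : (w, β) ∈ prodDomain M A,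
      SatA A (prodDomain M A) (prodModel M A) ⟨(w, β), h⟩ φ

/-- The set of points reachable from `ω` in at most `k` steps along `R`. -/
def reachWithin {W : Type} (M : Model W) (ω : W) : ℕ → Set W
  | 0 => {ω}
  | k + 1 => reachWithin M ω k ∪ {v | ∃ u ∈ reachWithin M ω k, M.rel u v}

theorem mem_reachWithin_self {W : Type} (M : Model W) (ω : W) (k : ℕ) :
    ω ∈ reachWithin M ω k := by
  induction k with
  | zero => exact rfl
  | succ k ih => exact Or.inl ih

/-- `M^k_ω`: the submodel of `M` generated by going at most `k` steps along `R` from `ω`. -/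
def Model.genSub {W : Type} (M : Model W) (ω : W) (k : ℕ) : Model (reachWithin M ω k) :=
  M.restrict (reachWithin M ω k)

/-- `φ ∈ L∃U` has degree `k`. -/
def HasDegreeForm (φ : Form) (k : ℕ) : Prop :=
  ∀ (W : Type) (M : Model W) (ω : W),
    Sat M ω φ ↔ Sat (M.genSub ω k) ⟨ω, mem_reachWithin_self M ω k⟩ φ

/-- `φ ∈ L∃Uα` has degree `k`. -/
def HasDegreeA {n : ℕ} (A : EventModel n) (φ : FormA n) (k : ℕ) : Prop :=
  ∀ (W : Type) (M : Model W) (ω : W),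
    SatA A W M ω φ ↔
      SatA A (reachWithin M ω k) (M.genSub ω k) ⟨ω, mem_reachWithin_self M ω k⟩ φ

/-- `deg(φ)` for `φ ∈ L∃U` (the least degree; `sInf ∅ = 0` by convention). -/
noncomputable def degForm (φ : Form) : ℕ := sInf {k | HasDegreeForm φ k}

/-- `deg(φ)` for `φ ∈ L∃Uα`. -/
noncomputable def degA {n : ℕ} (A : EventModel n) (φ : FormA n) : ℕ :=
  sInf {k | HasDegreeA A φ k}

/-- `Z` is a bisimulation between `M` and `M'`. -/
def IsBisim {W W' : Type} (M : Model W) (M' : Model W') (Z : W → W' → Prop) : Prop :=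
  ∀ s t, Z s t →
    (∀ p, s ∈ M.val p ↔ t ∈ M'.val p) ∧
    (∀ s₁, M.rel s s₁ → ∃ t₁, M'.rel t t₁ ∧ Z s₁ t₁) ∧
    (∀ t₁, M'.rel t t₁ → ∃ s₁, M.rel s s₁ ∧ Z s₁ t₁)

/-- `φ ∈ L∃U` is bisimulation-invariant. -/
def BisimInvariant (φ : Form) : Prop :=
  ∀ (W W' : Type) (M : Model W) (M' : Model W') (Z : W → W' → Prop),
    IsBisim M M' Z → ∀ w w', Z w w' → (Sat M w φ ↔ Sat M' w' φ)

/-- The modal fixpoint language `L_μ` (with greatest-fixpoint binders `ν`). -/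
inductive Formμ : Type where
  | atom : ℕ → Formμ
  | neg : Formμ → Formμ
  | and : Formμ → Formμ → Formμ
  | box : Formμ → Formμ
  | nu : ℕ → Formμ → Formμ

mutual
/-- All occurrences of `p` are under an even number of negations. -/
def PosIn (p : ℕ) : Formμ → Prop
  | .atom _ => True
  | .neg φ => NegIn p φ
  | .and φ ψ => PosIn p φ ∧ PosIn p ψ
  | .box φ => PosIn p φ
  | .nu q φ => q = p ∨ PosIn p φ

/-- All occurrences of `p` are under an odd number of negations. -/
def NegIn (p : ℕ) : Formμ → Prop
  | .atom q => q ≠ p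
  | .neg φ => PosIn p φ
  | .and φ ψ => NegIn p φ ∧ NegIn p ψ
  | .box φ => NegIn p φ
  | .nu q φ => q = p ∨ NegIn p φ
end

/-- Well-formedness for `L_μ`: in each `νp.φ`, `φ` is positive in `p`. -/
def WFμ : Formμ → Prop
  | .atom _ => True
  | .neg φ => WFμ φ
  | .and φ ψ => WFμ φ ∧ WFμ ψ
  | .box φ => WFμ φ
  | .nu q φ => PosIn q φ ∧ WFμ φ

/-- Satisfaction for `L_μ`: `⟦νp.φ⟧ = ⋃ {X | ∀ ω ∈ X, M[p ↦ X], ω ⊨ φ}`. -/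
def Satμ {W : Type} : Model W → W → Formμ → Prop
  | M, w, .atom p => w ∈ M.val p
  | M, w, .neg φ => ¬ Satμ M w φ
  | M, w, .and φ ψ => Satμ M w φ ∧ Satμ M w ψ
  | M, w, .box φ => ∀ v, M.rel w v → Satμ M v φ
  | M, w, .nu q φ => w ∈ ⋃₀ {X : Set W | ∀ v ∈ X, Satμ (M.update q X) v φ}

/-- An event model with preconditions in `L_μ`. -/
structure EventModelμ (n : ℕ) where
  E : Fin n → Fin n → Prop
  pre : Fin n → Formμ

/-- The domain of the product update `M ⊗ A` for `L_μ` event models. -/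
def prodDomainμ {W : Type} (M : Model W) {n : ℕ} (A : EventModelμ n) : Set (W × Fin n) :=
  {x | Satμ M x.1 (A.pre x.2)}

/-- The product update `M ⊗ A` for `L_μ` event models. -/
def prodModelμ {W : Type} (M : Model W) {n : ℕ} (A : EventModelμ n) :
    Model (prodDomainμ M A) :=
  ⟨fun x y => M.rel x.1.1 y.1.1 ∧ A.E x.1.2 y.1.2, fun p => {x | x.1.1 ∈ M.val p}⟩

/-- `Z` is an isomorphism between a submodel of `M` and a submodel of `M'`. -/
structure IsPartialIso {W W' : Type} (M : Model W) (M' : Model W') (Z : W → W' → Prop) :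
    Prop where
  right_unique : ∀ {a b b'}, Z a b → Z a b' → b = b'
  left_unique : ∀ {a a' b}, Z a b → Z a' b → a = a'
  rel_iff : ∀ {a b c d}, Z a b → Z c d → (M.rel a c ↔ M'.rel b d)
  val_iff : ∀ {a b}, Z a b → ∀ p, (a ∈ M.val p ↔ b ∈ M'.val p)

/-- `Z` is (the graph of) an isomorphism between `M` and `M'`. -/
structure IsIso {W W' : Type} (M : Model W) (M' : Model W') (Z : W → W' → Prop) : Prop
    extends IsPartialIso M M' Z where
  left_total : ∀ a, ∃ b, Z a b
  right_total : ∀ b, ∃ a, Z a b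

theorem IsPartialIso.symm {W W' : Type} {M : Model W} {M' : Model W'} {Z : W → W' → Prop}
    (h : IsPartialIso M M' Z) : IsPartialIso M' M (fun b a => Z a b) where
  right_unique := h.left_unique
  left_unique := h.right_unique
  rel_iff h₁ h₂ := (h.rel_iff h₁ h₂).symm
  val_iff h₁ p := (h.val_iff h₁ p).symm

theorem IsIso.symm {W W' : Type} {M : Model W} {M' : Model W'} {Z : W → W' → Prop}
    (h : IsIso M M' Z) : IsIso M' M (fun b a => Z a b) where
  toIsPartialIso := h.toIsPartialIso.symm
  left_total := h.right_total
  right_total := h.left_total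

theorem IsIso.update {W W' : Type} {M : Model W} {M' : Model W'} {Z : W → W' → Prop}
    (h : IsIso M M' Z) (p : ℕ) (X : Set W) :
    IsIso (M.update p X) (M'.update p {b | ∃ a ∈ X, Z a b}) Z where
  right_unique := h.right_unique
  left_unique := h.left_unique
  rel_iff := h.rel_iff
  val_iff {a b} hab q := by
    by_cases hq : q = p
    · simp only [Model.update, hq, if_true, Set.mem_ofPred_eq]
      exact ⟨fun ha => ⟨a, ha, hab⟩, fun ⟨a', ha', hz⟩ => h.left_unique hab hz ▸ ha'⟩
    · simpa only [Model.update, hq, if_false] using h.val_iff hab q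
  left_total := h.left_total
  right_total := h.right_total

theorem IsIso.sat_iff (φ : Form) : ∀ {W W' : Type} {M : Model W} {M' : Model W'}
    {Z : W → W' → Prop}, IsIso M M' Z → ∀ {w w'}, Z w w' → (Sat M w φ ↔ Sat M' w' φ) := by
  induction φ with
  | atom p => exact fun h _ _ hw => h.val_iff hw p
  | neg φ ih => exact fun h _ _ hw => not_congr (ih h hw)
  | and φ ψ ih₁ ih₂ => exact fun h _ _ hw => and_congr (ih₁ h hw) (ih₂ h hw)
  | box φ ih =>
    intro W W' M M' Z h w w' hw
    constructor
    · intro H v' hv'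
      obtain ⟨v, hv⟩ := h.right_total v'
      exact (ih h hv).1 (H v ((h.rel_iff hw hv).2 hv'))
    · intro H v hv
      obtain ⟨v', hv'⟩ := h.left_total v
      exact (ih h hv').2 (H v' ((h.rel_iff hw hv').1 hv))
  | ex p φ ih =>
    intro W W' M M' Z h w w' hw
    exact ⟨fun ⟨X, hX⟩ => ⟨_, (ih (h.update p X) hw).1 hX⟩,
      fun ⟨X, hX⟩ => ⟨_, (ih (h.symm.update p X) hw).1 hX⟩⟩
  | uni φ ih =>
    intro W W' M M' Z h w w' hw
    constructor
    · intro H v'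
      obtain ⟨v, hv⟩ := h.right_total v'
      exact (ih h hv).1 (H v)
    · intro H v
      obtain ⟨v', hv'⟩ := h.left_total v
      exact (ih h hv').2 (H v')

theorem exists_prop_congr_of_iff {p p' : Prop} {q : p → Prop} {q' : p' → Prop}
    (hp : p ↔ p') (hq : ∀ h h', q h ↔ q' h') : (∃ h, q h) ↔ ∃ h, q' h :=
  ⟨fun ⟨h, H⟩ => ⟨hp.1 h, (hq _ _).1 H⟩, fun ⟨h, H⟩ => ⟨hp.2 h, (hq _ _).2 H⟩⟩

/-- The relation between product updates induced by a relation between models. -/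
def prodRel {W W' : Type} {M : Model W} {M' : Model W'} {n : ℕ} {A : EventModel n}
    (Z : W → W' → Prop) (x : prodDomain M A) (y : prodDomain M' A) : Prop :=
  Z x.1.1 y.1.1 ∧ x.1.2 = y.1.2

theorem IsPartialIso.prodModel {W W' : Type} {M : Model W} {M' : Model W'}
    {Z : W → W' → Prop} (h : IsPartialIso M M' Z) {n : ℕ} (A : EventModel n) :
    IsPartialIso (prodModel M A) (prodModel M' A) (prodRel Z) where
  right_unique h₁ h₂ :=
    Subtype.ext (Prod.ext (h.right_unique h₁.1 h₂.1) (h₁.2.symm.trans h₂.2))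
  left_unique h₁ h₂ :=
    Subtype.ext (Prod.ext (h.left_unique h₁.1 h₂.1) (h₁.2.trans h₂.2.symm))
  rel_iff h₁ h₂ := and_congr (h.rel_iff h₁.1 h₂.1) (by rw [h₁.2, h₂.2])
  val_iff h₁ p := h.val_iff h₁.1 p

theorem IsIso.prodModel {W W' : Type} {M : Model W} {M' : Model W'} {Z : W → W' → Prop}
    (h : IsIso M M' Z) {n : ℕ} (A : EventModel n) :
    IsIso (prodModel M A) (prodModel M' A) (prodRel Z) where
  toIsPartialIso := h.toIsPartialIso.prodModel A
  left_total x := by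
    obtain ⟨b, hb⟩ := h.left_total x.1.1
    exact ⟨⟨(b, x.1.2), (h.sat_iff _ hb).1 x.2⟩, hb, rfl⟩
  right_total y := by
    obtain ⟨a, ha⟩ := h.right_total y.1.1
    exact ⟨⟨(a, y.1.2), (h.sat_iff _ ha).2 y.2⟩, ha, rfl⟩

theorem IsIso.satA_iff {n : ℕ} (A : EventModel n) (φ : FormA n) :
    ∀ {W W' : Type} {M : Model W} {M' : Model W'} {Z : W → W' → Prop}, IsIso M M' Z →
      ∀ {w w'}, Z w w' → (SatA A W M w φ ↔ SatA A W' M' w' φ) := by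
  induction φ with
  | atom p => exact fun h _ _ hw => h.val_iff hw p
  | neg φ ih => exact fun h _ _ hw => not_congr (ih h hw)
  | and φ ψ ih₁ ih₂ => exact fun h _ _ hw => and_congr (ih₁ h hw) (ih₂ h hw)
  | box φ ih =>
    intro W W' M M' Z h w w' hw
    constructor
    · intro H v' hv'
      obtain ⟨v, hv⟩ := h.right_total v'
      exact (ih h hv).1 (H v ((h.rel_iff hw hv).2 hv'))
    · intro H v hv
      obtain ⟨v', hv'⟩ := h.left_total v
      exact (ih h hv').2 (H v' ((h.rel_iff hw hv').1 hv))
  | ex p φ ih =>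
    intro W W' M M' Z h w w' hw
    exact ⟨fun ⟨X, hX⟩ => ⟨_, (ih (h.update p X) hw).1 hX⟩,
      fun ⟨X, hX⟩ => ⟨_, (ih (h.symm.update p X) hw).1 hX⟩⟩
  | uni φ ih =>
    intro W W' M M' Z h w w' hw
    constructor
    · intro H v'
      obtain ⟨v, hv⟩ := h.right_total v'
      exact (ih h hv).1 (H v)
    · intro H v
      obtain ⟨v', hv'⟩ := h.left_total v
      exact (ih h hv').2 (H v')
  | act β φ ih =>
    intro W W' M M' Z h w w' hw
    exact exists_prop_congr_of_iff (h.sat_iff _ hw) fun _ _ => ih (h.prodModel A) ⟨hw, rfl⟩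

theorem reachWithin_mono {W : Type} (M : Model W) (ω : W) : Monotone (reachWithin M ω) :=
  monotone_nat_of_le_succ fun _ => Set.subset_union_left

theorem reachWithin_trans {W : Type} {M : Model W} {ω u v : W} {m k : ℕ}
    (hu : u ∈ reachWithin M ω m) (hv : v ∈ reachWithin M u k) :
    v ∈ reachWithin M ω (m + k) := by
  induction k generalizing v with
  | zero => exact (show v = u from hv) ▸ hu
  | succ k ih =>
    obtain hv | ⟨x, hx, hxv⟩ := hv
    · exact Or.inl (ih hv)
    · exact Or.inr ⟨x, ih hx, hxv⟩

theorem map_mem_reachWithin {W W' : Type} {M : Model W} {M' : Model W'} (f : W → W')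
    (hf : ∀ a b, M.rel a b → M'.rel (f a) (f b)) {ω v : W} {k : ℕ}
    (hv : v ∈ reachWithin M ω k) : f v ∈ reachWithin M' (f ω) k := by
  induction k generalizing v with
  | zero => exact congrArg f (show v = ω from hv)
  | succ k ih =>
    obtain hv | ⟨x, hx, hxv⟩ := hv
    · exact Or.inl (ih hv)
    · exact Or.inr ⟨f x, ih hx, hf _ _ hxv⟩

theorem IsPartialIso.mem_reachWithin {W W' : Type} {M : Model W} {M' : Model W'}
    {Z : W → W' → Prop} (h : IsPartialIso M M' Z) {w : W} {w' : W'} (hw : Z w w') {k : ℕ}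
    (hdom : ∀ a ∈ reachWithin M w k, ∃ b, Z a b) {a : W} {b : W'} (hab : Z a b)
    (ha : a ∈ reachWithin M w k) : b ∈ reachWithin M' w' k := by
  induction k generalizing a b with
  | zero =>
    obtain rfl : a = w := ha
    exact h.right_unique hab hw
  | succ k ih =>
    have hdom' : ∀ a ∈ reachWithin M w k, ∃ b, Z a b := fun a ha => hdom a (Or.inl ha)
    obtain ha | ⟨x, hx, hxa⟩ := ha
    · exact Or.inl (ih hdom' hab ha)
    · obtain ⟨y, hy⟩ := hdom' x hx
      exact Or.inr ⟨y, ih hdom' hy hx, (h.rel_iff hy hab).1 hxa⟩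

theorem IsPartialIso.genSub {W W' : Type} {M : Model W} {M' : Model W'}
    {Z : W → W' → Prop} (h : IsPartialIso M M' Z) {w : W} {w' : W'} (hw : Z w w') {k : ℕ}
    (hdom : ∀ a ∈ reachWithin M w k, ∃ b, Z a b)
    (hran : ∀ b ∈ reachWithin M' w' k, ∃ a, Z a b) :
    IsIso (M.genSub w k) (M'.genSub w' k) (fun x y => Z x.1 y.1) where
  right_unique h₁ h₂ := Subtype.ext (h.right_unique h₁ h₂)
  left_unique h₁ h₂ := Subtype.ext (h.left_unique h₁ h₂)
  rel_iff h₁ h₂ := h.rel_iff h₁ h₂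
  val_iff h₁ p := h.val_iff h₁ p
  left_total x := by
    obtain ⟨b, hb⟩ := hdom x.1 x.2
    exact ⟨⟨b, h.mem_reachWithin hw hdom hb x.2⟩, hb⟩
  right_total y := by
    obtain ⟨a, ha⟩ := hran y.1 y.2
    exact ⟨⟨a, h.symm.mem_reachWithin hw hran ha y.2⟩, ha⟩

theorem HasDegreeForm.sat_iff {φ : Form} {k : ℕ} (hφ : HasDegreeForm φ k) {W W' : Type}
    {M : Model W} {M' : Model W'} {Z : W → W' → Prop} (h : IsPartialIso M M' Z) {w : W}
    {w' : W'} (hw : Z w w') (hdom : ∀ a ∈ reachWithin M w k, ∃ b, Z a b)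
    (hran : ∀ b ∈ reachWithin M' w' k, ∃ a, Z a b) : Sat M w φ ↔ Sat M' w' φ :=
  (hφ W M w).trans (((h.genSub hw hdom hran).sat_iff φ hw).trans (hφ W' M' w').symm)

theorem HasDegreeA.satA_iff {n : ℕ} {A : EventModel n} {φ : FormA n} {k : ℕ}
    (hφ : HasDegreeA A φ k) {W W' : Type} {M : Model W} {M' : Model W'}
    {Z : W → W' → Prop} (h : IsPartialIso M M' Z) {w : W} {w' : W'} (hw : Z w w')
    (hdom : ∀ a ∈ reachWithin M w k, ∃ b, Z a b)
    (hran : ∀ b ∈ reachWithin M' w' k, ∃ a, Z a b) :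
    SatA A W M w φ ↔ SatA A W' M' w' φ :=
  (hφ W M w).trans (((h.genSub hw hdom hran).satA_iff A φ hw).trans (hφ W' M' w').symm)

theorem isPartialIso_restrict {W : Type} (M : Model W) (S : Set W) :
    IsPartialIso M (M.restrict S) (fun a b => a = b.1) where
  right_unique h₁ h₂ := Subtype.ext (h₁.symm.trans h₂)
  left_unique h₁ h₂ := h₁.trans h₂.symm
  rel_iff := by rintro _ b _ d rfl rfl; rfl
  val_iff := by rintro _ b rfl p; rfl

theorem HasDegreeForm.sat_restrict_iff {φ : Form} {k : ℕ} (hφ : HasDegreeForm φ k)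
    {W : Type} {M : Model W} {S : Set W} (v : S) (hS : reachWithin M v.1 k ⊆ S) :
    Sat M v.1 φ ↔ Sat (M.restrict S) v φ :=
  hφ.sat_iff (isPartialIso_restrict M S) rfl (fun a ha => ⟨⟨a, hS ha⟩, rfl⟩)
    fun b _ => ⟨b.1, rfl⟩

theorem HasDegreeA.act {n : ℕ} {A : EventModel n} {φ : FormA n} {d m : ℕ}
    (hφ : HasDegreeA A φ m) (hpre : ∀ i, ∃ k ≤ d, HasDegreeForm (A.pre i) k) (α : Fin n) :
    HasDegreeA A (FormA.act α φ) (d + m) := by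
  intro W M ω
  have key : ∀ (v : reachWithin M ω (d + m)) (i : Fin n), v.1 ∈ reachWithin M ω m →
      (Sat M v.1 (A.pre i) ↔ Sat (M.genSub ω (d + m)) v (A.pre i)) := by
    intro v i hv
    obtain ⟨k, hk, hdeg⟩ := hpre i
    exact hdeg.sat_restrict_iff v fun x hx =>
      reachWithin_mono M ω (by omega) (reachWithin_trans hv hx)
  refine exists_prop_congr_of_iff (key ⟨ω, _⟩ α (mem_reachWithin_self M ω m)) fun _ _ =>
    hφ.satA_iff ((isPartialIso_restrict M _).prodModel A) ⟨rfl, rfl⟩ ?_ ?_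
  · intro x hx
    have hx' : x.1.1 ∈ reachWithin M ω m :=
      map_mem_reachWithin (M := prodModel M A) (fun y : prodDomain M A => y.1.1) (fun _ _ h => h.1) hx
    exact ⟨⟨(⟨x.1.1, reachWithin_mono M ω (by omega) hx'⟩, x.1.2),
      (key ⟨x.1.1, _⟩ x.1.2 hx').1 x.2⟩, rfl, rfl⟩
  · intro y hy
    have hy' : y.1.1.1 ∈ reachWithin M ω m :=
      map_mem_reachWithin (M := prodModel (M.genSub ω (d + m)) A) (fun z => z.1.1.1)
        (fun _ _ h => h.1) hy
    exact ⟨⟨(y.1.1.1, y.1.2), (key y.1.1 y.1.2 hy').2 y.2⟩, rfl, rfl⟩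

/-- Finite degree is preserved by action modalities: if `φ` and all the
preconditions have finite degree, then `⟨α⟩φ` has finite degree; indeed its degree is
at most `k* = max{deg(Pre_{α_0}), …, deg(Pre_{α_{n−1}})} + deg(φ)`. -/
theorem stmt7 (n : ℕ) (hn : 0 < n) (A : EventModel n) (φ : FormA n)
    (hφ : ∃ k, HasDegreeA A φ k) (hpre : ∀ i, ∃ k, HasDegreeForm (A.pre i) k)
    (α : Fin n) :
    HasDegreeA A (FormA.act α φ)
      ((Finset.univ.sup fun i => degForm (A.pre i)) + degA A φ) := by
  refine HasDegreeA.act (Nat.sInf_mem hφ) (fun i => ⟨degForm (A.pre i), ?_, ?_⟩) α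
  · exact Finset.le_sup (f := fun i => degForm (A.pre i)) (Finset.mem_univ i)
  · exact Nat.sInf_mem (hpre i)
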